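/- Let (P_n)_{n≥0} be a monic OPS with recurrence coefficients (B_n, C_n) satisfying 𝒟_q(𝒮_q P_n) = r_n P_{n−1} for all n ≥ 0, for some constants r_n ∈ ℂ. Then for every n ≥ 2: 2α·𝒮_q(𝒮_q P_n) = c_n^{[1]} P_n + c_n^{[2]} P_{n−1} + c_n^{[3]} P_{n−2}, where c_n^{[1]} = r_{n+1} − (2α² − 1)r_n + α, c_n^{[2]} = (B_n − (2α² − 1)B_{n−1})·r_n, and c_n^{[3]} = r_{n−1}C_n − (2α² − 1)r_n C_{n−1}. -/

import Mathlib

open Polynomial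

noncomputable section

/-- `q^{1/2}` as a complex number, for a real `q`. -/
def qh (q : ℝ) : ℂ := ((Real.sqrt q : ℝ) : ℂ)

/-- `α = (q^{1/2} + q^{-1/2})/2`. -/
def alp (q : ℝ) : ℂ := (qh q + (qh q)⁻¹) / 2

/-- `α_n = (q^{n/2} + q^{-n/2})/2` (so that `α_{-1} = α`). -/
def alpn (q : ℝ) (n : ℤ) : ℂ := ((qh q) ^ n + (qh q) ^ (-n)) / 2

/-- `γ_n = (q^{n/2} - q^{-n/2})/(q^{1/2} - q^{-1/2})` (so that `γ_{-1} = -1`). -/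
def gamn (q : ℝ) (n : ℤ) : ℂ := ((qh q) ^ n - (qh q) ^ (-n)) / (qh q - (qh q)⁻¹)

/-- `U₂(z) = (α² - 1)(z² - 1)` as a polynomial. -/
def U2 (q : ℝ) : ℂ[X] := Polynomial.C ((alp q) ^ 2 - 1) * (X ^ 2 - 1)

/-- Defining property of the Askey–Wilson operator `𝒟_q` on `ℂ[z]`:
for every `w ≠ 0` with `w² ≠ 1`,
`(𝒟_q p)((w+w⁻¹)/2) = [p((q^{1/2}w+q^{-1/2}w⁻¹)/2) − p((q^{-1/2}w+q^{1/2}w⁻¹)/2)]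
  / (((q^{1/2}−q^{-1/2})/2)(w−w⁻¹))`. -/
def IsAW (q : ℝ) (D : ℂ[X] → ℂ[X]) : Prop :=
  ∀ p : ℂ[X], ∀ w : ℂ, w ≠ 0 → w ^ 2 ≠ 1 →
    (D p).eval ((w + w⁻¹) / 2) =
      (p.eval ((qh q * w + (qh q)⁻¹ * w⁻¹) / 2) -
          p.eval (((qh q)⁻¹ * w + qh q * w⁻¹) / 2)) /
        (((qh q - (qh q)⁻¹) / 2) * (w - w⁻¹))

/-- Defining property of the averaging operator `𝒮_q` on `ℂ[z]`:
for every `w ≠ 0` with `w² ≠ 1`,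
`(𝒮_q p)((w+w⁻¹)/2) = (1/2)[p((q^{1/2}w+q^{-1/2}w⁻¹)/2) + p((q^{-1/2}w+q^{1/2}w⁻¹)/2)]`. -/
def IsAv (q : ℝ) (S : ℂ[X] → ℂ[X]) : Prop :=
  ∀ p : ℂ[X], ∀ w : ℂ, w ≠ 0 → w ^ 2 ≠ 1 →
    (S p).eval ((w + w⁻¹) / 2) =
      (p.eval ((qh q * w + (qh q)⁻¹ * w⁻¹) / 2) +
          p.eval (((qh q)⁻¹ * w + qh q * w⁻¹) / 2)) / 2

/-- A monic orthogonal polynomial sequence with recurrence coefficients `(B_n, C_n)`: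
monic polynomials, `deg P_n = n`, `P_0 = 1` and the three-term recurrence
`P_{n+1} = (z - B_n) P_n - C_n P_{n-1}` (with `P_{-1} = 0`), `C_n ≠ 0` for `n ≥ 1`. -/
structure MonicOPS (P : ℕ → ℂ[X]) (B Co : ℕ → ℂ) : Prop where
  monic : ∀ n, (P n).Monic
  deg : ∀ n, (P n).natDegree = n
  p0 : P 0 = 1
  p1 : P 1 = X - Polynomial.C (B 0)
  ttrr : ∀ n : ℕ,
    P (n + 2) = (X - Polynomial.C (B (n + 1))) * P (n + 1) - Polynomial.C (Co (n + 1)) * P n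
  Cne : ∀ n : ℕ, 1 ≤ n → Co n ≠ 0

/-- The Appell-type property `𝒮_q(𝒟_q P_n) = k_n P_{n-1}` for all `n ≥ 0` (with `P_{-1} = 0`). -/
def AppellSD (Sq Dq : ℂ[X] → ℂ[X]) (P : ℕ → ℂ[X]) (k : ℕ → ℂ) : Prop :=
  Sq (Dq (P 0)) = 0 ∧ ∀ n : ℕ, Sq (Dq (P (n + 1))) = Polynomial.C (k (n + 1)) * P n

/-- The Appell-type property `𝒟_q(𝒮_q P_n) = k_n P_{n-1}` for all `n ≥ 0` (with `P_{-1} = 0`). -/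
def AppellDS (Dq Sq : ℂ[X] → ℂ[X]) (P : ℕ → ℂ[X]) (k : ℕ → ℂ) : Prop :=
  Dq (Sq (P 0)) = 0 ∧ ∀ n : ℕ, Dq (Sq (P (n + 1))) = Polynomial.C (k (n + 1)) * P n

end

theorem aux_ext (h : ℝ) (hh0 : 0 < h) (hh1 : h < 1) (p g : ℂ[X])
    (H : ∀ w : ℂ, w ≠ 0 → w ^ 2 ≠ 1 → ((h : ℂ) * w) ^ 2 ≠ 1 → ((h : ℂ)⁻¹ * w) ^ 2 ≠ 1 →
      p.eval ((w + w⁻¹) / 2) = g.eval ((w + w⁻¹) / 2)) : p = g := by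
  apply Polynomial.eq_of_infinite_eval_eq
  have hinv : 1 < h⁻¹ := (one_lt_inv₀ hh0).2 hh1
  refine Set.infinite_of_injOn_mapsTo (s := Set.Ioi (h⁻¹))
    (f := fun t : ℝ => (((t + t⁻¹) / 2 : ℝ) : ℂ)) ?_ ?_ (Set.Ioi_infinite _)
  · intro t ht s hs hts
    have ht1 : 1 < t := lt_trans hinv ht
    have hs1 : 1 < s := lt_trans hinv hs
    have e : (t + t⁻¹) / 2 = (s + s⁻¹) / 2 := Complex.ofReal_injective hts
    have t0 : t ≠ 0 := by positivity
    have s0 : s ≠ 0 := by positivity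
    field_simp at e
    have e2 : (t - s) * (t * s - 1) = 0 := by linear_combination e
    rcases mul_eq_zero.1 e2 with h1 | h1
    · linarith
    · nlinarith
  · intro t ht
    have ht' : h⁻¹ < t := ht
    have ht1 : 1 < t := lt_trans hinv ht'
    have a1 : 1 < h * t := by
      have := mul_lt_mul_of_pos_left ht' hh0
      rwa [mul_inv_cancel₀ hh0.ne'] at this
    have a2 : 1 < h⁻¹ * t := by nlinarith
    have sq : ∀ x : ℝ, 1 < x → x ^ 2 ≠ 1 := by
      intro x hx hx2
      nlinarith
    have := H (t : ℂ) (by exact_mod_cast (by positivity : t ≠ 0))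
      (by exact_mod_cast sq t ht1) (by exact_mod_cast sq _ a1) (by exact_mod_cast sq _ a2)
    simpa using this

/-- Evaluation of `D S g`. -/
theorem aux_DS (q : ℝ) (h0 : qh q ≠ 0) (h1 : (qh q) ^ 2 ≠ 1)
    (Dq Sq : ℂ[X] → ℂ[X]) (hD : IsAW q Dq) (hS : IsAv q Sq) (g : ℂ[X]) (w : ℂ)
    (w0 : w ≠ 0) (w1 : w ^ 2 ≠ 1) (w2 : (qh q * w) ^ 2 ≠ 1) (w3 : ((qh q)⁻¹ * w) ^ 2 ≠ 1) :
    (Dq (Sq g)).eval ((w + w⁻¹) / 2) =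
      (g.eval (((qh q) ^ 2 * w + ((qh q) ^ 2 * w)⁻¹) / 2) -
        g.eval ((((qh q) ^ 2)⁻¹ * w + (qh q) ^ 2 * w⁻¹) / 2)) /
        ((qh q - (qh q)⁻¹) * (w - w⁻¹)) ∧
    (Sq (Sq g)).eval ((w + w⁻¹) / 2) =
      (g.eval (((qh q) ^ 2 * w + ((qh q) ^ 2 * w)⁻¹) / 2) + 2 * g.eval ((w + w⁻¹) / 2) +
        g.eval ((((qh q) ^ 2)⁻¹ * w + (qh q) ^ 2 * w⁻¹) / 2)) / 4 := by
  rw [hD _ w w0 w1, hS _ w w0 w1]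
  have e1 := hS g (qh q * w) (mul_ne_zero h0 w0) w2
  have e2 := hS g ((qh q)⁻¹ * w) (mul_ne_zero (inv_ne_zero h0) w0) w3
  generalize qh q = h at *
  rw [show (h * w + (h * w)⁻¹) / 2 = (h * w + h⁻¹ * w⁻¹) / 2 by rw [mul_inv],
    show (h * (h * w) + h⁻¹ * (h * w)⁻¹) / 2 = (h ^ 2 * w + (h ^ 2 * w)⁻¹) / 2 by
      field_simp,
    show (h⁻¹ * (h * w) + h * (h * w)⁻¹) / 2 = (w + w⁻¹) / 2 by field_simp] at e1
  rw [show (h⁻¹ * w + (h⁻¹ * w)⁻¹) / 2 = (h⁻¹ * w + h * w⁻¹) / 2 by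
      rw [mul_inv, inv_inv],
    show (h * (h⁻¹ * w) + h⁻¹ * (h⁻¹ * w)⁻¹) / 2 = (w + w⁻¹) / 2 by field_simp,
    show (h⁻¹ * (h⁻¹ * w) + h * (h⁻¹ * w)⁻¹) / 2 = ((h ^ 2)⁻¹ * w + h ^ 2 * w⁻¹) / 2 by
      field_simp] at e2
  rw [e1, e2]
  constructor
  · have d1 : h - h⁻¹ ≠ 0 := by
      intro hc
      apply h1
      field_simp at hc
      linear_combination hc
    have d2 : w - w⁻¹ ≠ 0 := by
      intro hc
      apply w1
      field_simp at hc
      linear_combination hc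
    generalize h - h⁻¹ = d at *
    generalize w - w⁻¹ = d' at *
    field_simp
    ring
  · ring

theorem aux_qh (q : ℝ) (hq0 : 0 < q) (hq1 : q < 1) : 0 < Real.sqrt q ∧ Real.sqrt q < 1 ∧
    qh q ≠ 0 ∧ (qh q) ^ 2 ≠ 1 := by
  have a := Real.sqrt_pos.2 hq0
  have b : Real.sqrt q < 1 := by
    rw [Real.sqrt_lt' one_pos]
    simpa using hq1
  refine ⟨a, b, ?_, ?_⟩
  · unfold qh
    exact_mod_cast a.ne'
  · unfold qh
    have : Real.sqrt q ^ 2 ≠ 1 := by nlinarith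
    exact_mod_cast this

theorem aux_lin (q : ℝ) (hq0 : 0 < q) (hq1 : q < 1)
    (Dq Sq : ℂ[X] → ℂ[X]) (hD : IsAW q Dq) (hS : IsAv q Sq) (f g k : ℂ[X]) (b c : ℂ) :
    Dq (Sq (f + C b * g + C c * k)) =
      Dq (Sq f) + C b * Dq (Sq g) + C c * Dq (Sq k) := by
  obtain ⟨a1, a2, h0, h1⟩ := aux_qh q hq0 hq1
  apply aux_ext _ a1 a2
  intro w w0 w1 w2 w3
  have E := fun g => (aux_DS q h0 h1 Dq Sq hD hS g w w0 w1 w2 w3).1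
  simp only [eval_add, eval_mul, eval_C, E]
  ring

theorem aux_key (q : ℝ) (hq0 : 0 < q) (hq1 : q < 1)
    (Dq Sq : ℂ[X] → ℂ[X]) (hD : IsAW q Dq) (hS : IsAv q Sq) (f : ℂ[X]) :
    C (2 * alp q) * Sq (Sq f) =
      Dq (Sq (X * f)) - C (2 * (alp q) ^ 2 - 1) * (X * Dq (Sq f)) + C (alp q) * f := by
  obtain ⟨a1, a2, h0, h1⟩ := aux_qh q hq0 hq1
  apply aux_ext _ a1 a2
  intro w w0 w1 w2 w3
  have E := fun g => (aux_DS q h0 h1 Dq Sq hD hS g w w0 w1 w2 w3).1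
  have E' := (aux_DS q h0 h1 Dq Sq hD hS f w w0 w1 w2 w3).2
  simp only [eval_add, eval_sub, eval_mul, eval_C, eval_X, E, E', alp]
  generalize qh q = h at *
  generalize f.eval ((h ^ 2 * w + (h ^ 2 * w)⁻¹) / 2) = fa
  generalize f.eval (((h ^ 2)⁻¹ * w + h ^ 2 * w⁻¹) / 2) = fc
  generalize f.eval ((w + w⁻¹) / 2) = fm
  have d1 : h ^ 2 - 1 ≠ 0 := sub_ne_zero.2 h1
  have d2 : w ^ 2 - 1 ≠ 0 := sub_ne_zero.2 w1
  have r1 : h - h⁻¹ = (h ^ 2 - 1) / h := by field_simp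
  have r2 : w - w⁻¹ = (w ^ 2 - 1) / w := by field_simp
  rw [r1, r2]
  field_simp
  ring

/-- for a monic OPS with `𝒟_q(𝒮_q P_n) = r_n P_{n-1}`, for every `n ≥ 2`,
`2α·𝒮_q²P_n = c_n^{[1]} P_n + c_n^{[2]} P_{n−1} + c_n^{[3]} P_{n−2}`. -/
theorem stmt_13 (q : ℝ) (hq0 : 0 < q) (hq1 : q < 1)
    (Dq Sq : ℂ[X] → ℂ[X]) (hD : IsAW q Dq) (hS : IsAv q Sq)
    (P : ℕ → ℂ[X]) (B Co : ℕ → ℂ) (hops : MonicOPS P B Co)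
    (r : ℕ → ℂ) (hAp : AppellDS Dq Sq P r) :
    ∀ n : ℕ, 2 ≤ n →
      Polynomial.C (2 * alp q) * Sq (Sq (P n)) =
        Polynomial.C (r (n + 1) - (2 * (alp q) ^ 2 - 1) * r n + alp q) * P n +
        Polynomial.C ((B n - (2 * (alp q) ^ 2 - 1) * B (n - 1)) * r n) * P (n - 1) +
        Polynomial.C (r (n - 1) * Co n - (2 * (alp q) ^ 2 - 1) * r n * Co (n - 1)) *
          P (n - 2) := by
  intro n hn
  obtain ⟨m, rfl⟩ : ∃ m, n = m + 2 := ⟨n - 2, by omega⟩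
  have t1 := hops.ttrr (m + 1)
  have t0 := hops.ttrr m
  have x1 : X * P (m + 2) = P (m + 3) + Polynomial.C (B (m + 2)) * P (m + 2) +
      Polynomial.C (Co (m + 2)) * P (m + 1) := by
    linear_combination -t1
  have x0 : X * P (m + 1) = P (m + 2) + Polynomial.C (B (m + 1)) * P (m + 1) +
      Polynomial.C (Co (m + 1)) * P m := by
    linear_combination -t0
  rw [aux_key q hq0 hq1 Dq Sq hD hS, x1, aux_lin q hq0 hq1 Dq Sq hD hS,
    hAp.2 (m + 2), hAp.2 (m + 1), hAp.2 m]
  simp only [show m + 2 - 1 = m + 1 by omega, show m + 2 - 2 = m by omega,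
    show m + 1 + 1 = m + 2 by omega, show m + 2 + 1 = m + 3 by omega]
  simp only [map_add, map_sub, map_mul]
  linear_combination (-(Polynomial.C 2 * Polynomial.C (alp q ^ 2) - Polynomial.C 1) *
    Polynomial.C (r (m + 2))) * x0
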